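/- Let x0, h ∈ ℝⁿ with ‖x0‖₂ = 1, let α ∈ (0, 1], let Ω = supp(x0) with |Ω| ≤ k, let λ > 0 with ξ := λ√k satisfying (1/2)·α < ξ < (3/4)·α, and let 0 ≤ δ < α/20 (so in particular δ < 1/20). Suppose that ‖h_{Ω^c}‖₁ ≤ √k·‖h_Ω‖₂ + (α/λ)·⟨x0, h_Ω⟩ + (1/λ)·‖h_{x0^⊥}‖₂, that ⟨x0, h⟩ ≤ −(1 − δ)·‖h‖₂, and that ‖h_{x0^⊥}‖₂ ≤ δ·‖h‖₂, where h_{x0^⊥} = h − ⟨x0, h⟩·x0. Then ‖h_{Ω^c}‖₁ ≤ −0.16·√k·‖h‖₂, and consequently h = 0. -/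

import Mathlib

/-- The ℓ² (Euclidean) norm on ℝⁿ. -/
noncomputable def l2norm {n : ℕ} (x : Fin n → ℝ) : ℝ := Real.sqrt (∑ j, (x j) ^ 2)

/-- The ℓ¹ norm on ℝⁿ. -/
noncomputable def l1norm {n : ℕ} (x : Fin n → ℝ) : ℝ := ∑ j, |x j|

/-- The Euclidean inner product on ℝⁿ. -/
noncomputable def dot {n : ℕ} (x y : Fin n → ℝ) : ℝ := ∑ j, x j * y j

theorem l2norm_nonneg {n : ℕ} (x : Fin n → ℝ) : 0 ≤ l2norm x := Real.sqrt_nonneg _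

theorem l1norm_nonneg {n : ℕ} (x : Fin n → ℝ) : 0 ≤ l1norm x :=
  Finset.sum_nonneg fun _ _ => abs_nonneg _

theorem eq_zero_of_l2norm_eq_zero {n : ℕ} {x : Fin n → ℝ} (hx : l2norm x = 0) : x = 0 := by
  rw [l2norm, Real.sqrt_eq_zero (Finset.sum_nonneg fun _ _ => sq_nonneg _),
    Finset.sum_eq_zero_iff_of_nonneg fun _ _ => sq_nonneg _] at hx
  ext j
  simpa using hx j (Finset.mem_univ j)

theorem l2norm_indicator_le {n : ℕ} (S : Set (Fin n)) (x : Fin n → ℝ) :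
    l2norm (S.indicator x) ≤ l2norm x := by
  refine Real.sqrt_le_sqrt (Finset.sum_le_sum fun j _ => ?_)
  by_cases hj : j ∈ S
  · simp [hj]
  · simpa [hj] using sq_nonneg (x j)

theorem dot_indicator_support {n : ℕ} (x y : Fin n → ℝ) :
    dot x ((Function.support x).indicator y) = dot x y := by
  refine Finset.sum_congr rfl fun j _ => ?_
  by_cases hj : x j = 0
  · simp [hj]
  · rw [Set.indicator_of_mem (Function.mem_support.2 hj)]

/-- **Final contradiction step of the main proof.** With `‖x0‖₂ = 1`, `α ∈ (0, 1]`,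
`Ω = supp(x0)`, `|Ω| ≤ k`, `ξ = λ√k ∈ ((1/2)·α, (3/4)·α)`, and `0 ≤ δ < α/20`, if
`‖h_{Ω^c}‖₁ ≤ √k·‖h_Ω‖₂ + (α/λ)·⟨x0, h_Ω⟩ + (1/λ)·‖h_{x0^⊥}‖₂`,
`⟨x0, h⟩ ≤ −(1 − δ)·‖h‖₂`, and `‖h_{x0^⊥}‖₂ ≤ δ·‖h‖₂` with `h_{x0^⊥} = h − ⟨x0, h⟩·x0`,
then `‖h_{Ω^c}‖₁ ≤ −0.16·√k·‖h‖₂` and consequently `h = 0`. -/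
theorem final_contradiction {n k : ℕ} (x0 h : Fin n → ℝ) (lam α ξ δ : ℝ)
    (hx0 : l2norm x0 = 1) (hαpos : 0 < α) (hα1 : α ≤ 1)
    (hk : (Function.support x0).ncard ≤ k)
    (hlam : 0 < lam) (hξ : ξ = lam * Real.sqrt k)
    (hξlo : (1 / 2) * α < ξ) (hξhi : ξ < (3 / 4) * α)
    (hδ0 : 0 ≤ δ) (hδ : δ < α / 20)
    (hbound : l1norm ((Function.support x0)ᶜ.indicator h) ≤
      Real.sqrt k * l2norm ((Function.support x0).indicator h) +
        (α / lam) * dot x0 ((Function.support x0).indicator h) +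
        (1 / lam) * l2norm (h - dot x0 h • x0))
    (hcorr : dot x0 h ≤ -(1 - δ) * l2norm h)
    (hperp : l2norm (h - dot x0 h • x0) ≤ δ * l2norm h) :
    l1norm ((Function.support x0)ᶜ.indicator h) ≤ -0.16 * Real.sqrt k * l2norm h ∧
      h = 0 := by
  have hN := l2norm_nonneg h
  have hL := l1norm_nonneg ((Function.support x0)ᶜ.indicator h)
  have hΩ := l2norm_indicator_le (Function.support x0) h
  rw [dot_indicator_support] at hbound
  set N := l2norm h
  set s := Real.sqrt k
  have hs : 0 < s := pos_of_mul_pos_right (by linarith : 0 < lam * s) hlam.le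
  have hδα : δ * α ≤ δ := mul_le_of_le_one_right hδ0 hα1
  have hcoef : -(α * (1 - δ)) + δ ≤ -(6 / 5) * (lam * s) := by linarith
  have hnum : α * dot x0 h + l2norm (h - dot x0 h • x0) ≤ -(6 / 5) * s * N * lam := by
    have h1 := mul_le_mul_of_nonneg_left hcorr hαpos.le
    have h2 := mul_le_mul_of_nonneg_right hcoef hN
    linarith
  have hquot : α / lam * dot x0 h + 1 / lam * l2norm (h - dot x0 h • x0)
      ≤ -(6 / 5) * s * N := by
    rw [← div_le_iff₀ hlam] at hnum
    rwa [div_mul_eq_mul_div, div_mul_eq_mul_div, one_mul, ← add_div]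
  have hsΩ := mul_le_mul_of_nonneg_left hΩ hs.le
  have hsN : 0 ≤ s * N := mul_nonneg hs.le hN
  refine ⟨by linarith, eq_zero_of_l2norm_eq_zero ?_⟩
  have hsN0 : s * N = 0 := by linarith
  exact (mul_eq_zero.1 hsN0).resolve_left hs.ne'
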